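/- arXiv:2504.04576 — 2 statements merged into one kernel-verified Lean document; each statement's English description precedes it below -/
import Mathlib

section
/- (Generalized order relation for arbitrary full-column-rank transformations.) Let J ∈ ℝ^{n×n} be symmetric positive definite and let A ∈ ℝ^{n×m} have full column rank m. Then Aᵀ J⁻¹ A ⪰ (Aᵀ A)(Aᵀ J A)⁻¹(Aᵀ A); in particular, when AᵀA = I_m this reduces to Aᵀ J⁻¹ A ⪰ (Aᵀ J A)⁻¹. -/
open Matrix

theorem Matrix.nonsing_inv_mul_self_mul_nonsing_inv {ι R : Type*} [Fintype ι] [DecidableEq ι]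
    [CommRing R] (K : Matrix ι ι R) : K⁻¹ * K * K⁻¹ = K⁻¹ := by
  by_cases h : IsUnit K.det
  · rw [Matrix.nonsing_inv_mul K h, Matrix.one_mul]
  · simp [Matrix.nonsing_inv_apply_not_isUnit K h]

/-- The order relation holds for every `A`: when `Aᵀ * J * A` is singular, its inverse is `0`. -/
theorem Matrix.PosDef.posSemidef_transpose_mul_inv_mul_sub {ι κ : Type*} [Fintype ι]
    [DecidableEq ι] [Fintype κ] [DecidableEq κ] {J : Matrix ι ι ℝ} (hJ : J.PosDef)
    (A : Matrix ι κ ℝ) :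
    (Aᵀ * J⁻¹ * A - (Aᵀ * A) * (Aᵀ * J * A)⁻¹ * (Aᵀ * A)).PosSemidef := by
  have hJT : Jᵀ = J := by simpa using hJ.isHermitian.eq
  have hdet : IsUnit J.det := (Matrix.isUnit_iff_isUnit_det J).mp hJ.isUnit
  set K := Aᵀ * J * A with hK
  have hKT : Kᵀ = K := by
    simp only [hK, Matrix.transpose_mul, Matrix.transpose_transpose, hJT, Matrix.mul_assoc]
  have hJD : J * (J⁻¹ * A - A * K⁻¹ * (Aᵀ * A)) = A - J * A * K⁻¹ * (Aᵀ * A) := by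
    rw [Matrix.mul_sub, Matrix.mul_nonsing_inv_cancel_left _ _ hdet]
    simp only [Matrix.mul_assoc]
  have hcross : Aᵀ * J⁻¹ * (J * A * K⁻¹ * (Aᵀ * A)) = (Aᵀ * A) * K⁻¹ * (Aᵀ * A) := by
    simp only [Matrix.mul_assoc, Matrix.nonsing_inv_mul_cancel_left _ _ hdet]
  have hsquare : (Aᵀ * A) * K⁻¹ * Aᵀ * (J * A * K⁻¹ * (Aᵀ * A))
      = (Aᵀ * A) * K⁻¹ * (Aᵀ * A) := by
    calc _ = (Aᵀ * A) * (K⁻¹ * K * K⁻¹) * (Aᵀ * A) := by simp only [hK, Matrix.mul_assoc]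
      _ = _ := by rw [Matrix.nonsing_inv_mul_self_mul_nonsing_inv]
  convert hJ.posSemidef.conjTranspose_mul_mul_same (J⁻¹ * A - A * K⁻¹ * (Aᵀ * A)) using 1
  rw [Matrix.mul_assoc (_ᴴ), hJD, Matrix.conjTranspose_eq_transpose_of_trivial, Matrix.transpose_sub]
  simp only [Matrix.transpose_mul, Matrix.transpose_nonsing_inv, hJT, hKT,
    Matrix.transpose_transpose]
  rw [← Matrix.mul_assoc (Aᵀ * A) K⁻¹ Aᵀ, Matrix.sub_mul, Matrix.mul_sub, Matrix.mul_sub, hcross,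
    hsquare, Matrix.mul_assoc _ Aᵀ A]
  abel

/-- Generalized order relation for arbitrary full-column-rank transformations:
for symmetric positive definite `J` and full-column-rank `A`,
`Aᵀ J⁻¹ A ⪰ (Aᵀ A)(Aᵀ J A)⁻¹(Aᵀ A)`; in particular, if `AᵀA = I` this reduces to
`Aᵀ J⁻¹ A ⪰ (Aᵀ J A)⁻¹`. -/
theorem generalized_oracle_bound_order {n m : ℕ}
    (J : Matrix (Fin n) (Fin n) ℝ) (hJ : J.PosDef)
    (A : Matrix (Fin n) (Fin m) ℝ) (hA : A.rank = m) :
    (Aᵀ * J⁻¹ * A - (Aᵀ * A) * (Aᵀ * J * A)⁻¹ * (Aᵀ * A)).PosSemidef ∧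
      (Aᵀ * A = (1 : Matrix (Fin m) (Fin m) ℝ) →
        (Aᵀ * J⁻¹ * A - (Aᵀ * J * A)⁻¹).PosSemidef) := by
  have h := hJ.posSemidef_transpose_mul_inv_mul_sub A
  refine ⟨h, fun hAA => ?_⟩
  simpa only [hAA, Matrix.one_mul, Matrix.mul_one] using h
end

section
/- (Block-diagonal pseudo-determinant identity for K connected components.) Let {V_1, …, V_K} be a partition of {1, …, M} into nonempty sets, and for each k let 𝟙_k ∈ ℝ^M be the indicator vector of V_k. Let L ∈ ℝ^{M×M} be symmetric positive semidefinite with L_{ij} = 0 whenever i and j lie in different blocks, and with kernel exactly the span of {𝟙_1, …, 𝟙_K}. Define D̄ = Σ_{k=1}^{K} (1/|V_k|) 𝟙_k 𝟙_kᵀ. Then L + D̄ is symmetric positive definite and det(L + D̄) equals the product of the M − K nonzero eigenvalues of L (counted with multiplicity). -/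
open Matrix

/-- If `P` fixes the kernel of a Hermitian matrix `L` pointwise and annihilates its range, then
`det (L + P)` is the product of the nonzero eigenvalues of `L`. -/
theorem Matrix.IsHermitian.det_add_eq_prod_nonzero_eigenvalues {n : Type*} [Fintype n]
    [DecidableEq n] {L P : Matrix n n ℝ} (hL : L.IsHermitian)
    (hfix : ∀ x, L *ᵥ x = 0 → P *ᵥ x = x) (hPL : P * L = 0) :
    (L + P).det =
      ∏ i ∈ Finset.univ.filter (fun i => hL.eigenvalues i ≠ 0), hL.eigenvalues i := by
  let U : Matrix n n ℝ := hL.eigenvectorUnitary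
  set μ : n → ℝ := fun i => if hL.eigenvalues i ≠ 0 then hL.eigenvalues i else 1 with hμ
  have hcol (j : n) : (L + P) *ᵥ ⇑(hL.eigenvectorBasis j) =
      μ j • ⇑(hL.eigenvectorBasis j) := by
    have hj := hL.mulVec_eigenvectorBasis j
    rw [add_mulVec, hj]
    by_cases h : hL.eigenvalues j = 0
    · rw [h, zero_smul] at hj
      simp [hμ, h, hfix _ hj]
    · have hP : hL.eigenvalues j • (P *ᵥ ⇑(hL.eigenvectorBasis j)) = 0 := by
        rw [← mulVec_smul, ← hj, mulVec_mulVec, hPL, zero_mulVec]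
      simp [hμ, h, (smul_eq_zero.mp hP).resolve_left h]
  have hdiag : (L + P) * U = U * diagonal μ := by
    ext i j
    have h := congrFun (hcol j) i
    rw [mul_diagonal, mul_comm (U i j)]
    exact h
  have hdetU : U.det ≠ 0 :=
    (UnitaryGroup.det_isUnit hL.eigenvectorUnitary).ne_zero
  have hdet := congrArg det hdiag
  rw [det_mul, det_mul, mul_comm U.det] at hdet
  rw [mul_right_cancel₀ hdetU hdet, det_diagonal, Finset.prod_filter]

theorem Matrix.IsHermitian.card_nonzero_eigenvalues_add_finrank_ker {n : Type*} [Fintype n]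
    [DecidableEq n] {L : Matrix n n ℝ} (hL : L.IsHermitian) :
    (Finset.univ.filter (fun i => hL.eigenvalues i ≠ 0)).card +
      Module.finrank ℝ (LinearMap.ker L.mulVecLin) = Fintype.card n := by
  rw [← Fintype.card_subtype, ← hL.rank_eq_card_non_zero_eigs, Matrix.rank,
    LinearMap.finrank_range_add_finrank_ker, Module.finrank_fintype_fun_eq_card]

section OrthogonalFamily

variable {n ι : Type*} [Fintype n] [Fintype ι] [DecidableEq ι] {v : ι → n → ℝ} {c : ι → ℝ}

theorem linearIndependent_of_dotProduct_eq_ite (hc : ∀ k, c k ≠ 0)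
    (hv : ∀ k l, v k ⬝ᵥ v l = if k = l then c k else 0) : LinearIndependent ℝ v := by
  rw [Fintype.linearIndependent_iff]
  intro g hg k
  have h := congrArg (v k ⬝ᵥ ·) hg
  simpa [dotProduct_sum, hv, hc k] using h

theorem sum_inv_smul_vecMulVec_mulVec_of_mem_span (hc : ∀ k, c k ≠ 0)
    (hv : ∀ k l, v k ⬝ᵥ v l = if k = l then c k else 0) {x : n → ℝ}
    (hx : x ∈ Submodule.span ℝ (Set.range v)) :
    (∑ k, (c k)⁻¹ • vecMulVec (v k) (v k)) *ᵥ x = x := by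
  induction hx using Submodule.span_induction with
  | mem x hx =>
    obtain ⟨l, rfl⟩ := hx
    simp [sum_mulVec, smul_mulVec, vecMulVec_mulVec, hv, hc, ite_smul, smul_smul, apply_ite]
  | zero => simp
  | add x y _ _ hx hy => rw [mulVec_add, hx, hy]
  | smul a x _ hx => rw [mulVec_smul, hx]

end OrthogonalFamily

/-- Block-diagonal pseudo-determinant identity for `K` connected components:
if `{V_1, …, V_K}` partitions `{1, …, M}` into nonempty sets, `L` is symmetric positive
semidefinite with `L_{ij} = 0` across distinct blocks and kernel exactly the span of the
block indicator vectors `𝟙_k`, then with `D̄ = Σ_k (1/|V_k|) 𝟙_k 𝟙_kᵀ` the matrix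
`L + D̄` is symmetric positive definite and `det(L + D̄)` equals the product of the
`M − K` nonzero eigenvalues of `L` (counted with multiplicity). -/
theorem block_pseudo_determinant_identity (M K : ℕ)
    (V : Fin K → Finset (Fin M))
    (hne : ∀ k, (V k).Nonempty)
    (hdisj : ∀ k l : Fin K, k ≠ l → Disjoint (V k) (V l))
    (hcover : ∀ i : Fin M, ∃ k : Fin K, i ∈ V k)
    (ind : Fin K → Fin M → ℝ)
    (hind : ∀ k, ind k = fun i => if i ∈ V k then (1 : ℝ) else 0)
    (L : Matrix (Fin M) (Fin M) ℝ)
    (hherm : L.IsHermitian)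
    (hpsd : L.PosSemidef)
    (hblock : ∀ (i j : Fin M) (k l : Fin K), k ≠ l → i ∈ V k → j ∈ V l → L i j = 0)
    (hker0 : ∀ k, L.mulVec (ind k) = 0)
    (hker : ∀ x : Fin M → ℝ, L.mulVec x = 0 →
      x ∈ Submodule.span ℝ (Set.range ind))
    (Dbar : Matrix (Fin M) (Fin M) ℝ)
    (hDbar : Dbar = ∑ k, (((V k).card : ℝ)⁻¹) • Matrix.vecMulVec (ind k) (ind k)) :
    (L + Dbar).PosDef ∧
    (Finset.univ.filter (fun i => hherm.eigenvalues i ≠ 0)).card = M - K ∧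
    (L + Dbar).det =
      ∏ i ∈ Finset.univ.filter (fun i => hherm.eigenvalues i ≠ 0),
        hherm.eigenvalues i := by
  have hc (k : Fin K) : ((V k).card : ℝ) ≠ 0 :=
    Nat.cast_ne_zero.mpr (Finset.card_ne_zero.mpr (hne k))
  have hdot (k l : Fin K) : ind k ⬝ᵥ ind l = if k = l then ((V k).card : ℝ) else 0 := by
    have hinter : ind k ⬝ᵥ ind l = ((V k ∩ V l).card : ℝ) := by
      simp [hind, dotProduct, ← ite_and, ← Finset.mem_inter, Finset.inter_comm]
    rw [hinter]
    split_ifs with h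
    · rw [h, Finset.inter_self]
    · simp [Finset.disjoint_iff_inter_eq_empty.mp (hdisj k l h)]
  have hfix (x : Fin M → ℝ) (hx : L *ᵥ x = 0) : Dbar *ᵥ x = x := by
    rw [hDbar]
    exact sum_inv_smul_vecMulVec_mulVec_of_mem_span hc hdot (hker x hx)
  have hDL : Dbar * L = 0 := by
    have hT : Lᵀ = L := by simpa [IsHermitian, conjTranspose_eq_transpose_of_trivial] using hherm
    have hvec (k : Fin K) : ind k ᵥ* L = 0 := by rw [← mulVec_transpose, hT, hker0]
    simp [hDbar, Finset.sum_mul, vecMulVec_mul, hvec]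
  have hdet := hherm.det_add_eq_prod_nonzero_eigenvalues hfix hDL
  have hkereq : LinearMap.ker L.mulVecLin = Submodule.span ℝ (Set.range ind) := by
    refine le_antisymm (fun x hx => hker x hx) (Submodule.span_le.mpr ?_)
    rintro _ ⟨k, rfl⟩
    exact hker0 k
  refine ⟨?_, ?_, hdet⟩
  · have hD : Dbar.PosSemidef := by
      rw [hDbar]
      refine posSemidef_sum _ fun k _ => PosSemidef.smul ?_ (by positivity)
      simpa using posSemidef_vecMulVec_self_star (ind k)
    rw [(hpsd.add hD).posDef_iff_det_ne_zero, hdet]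
    exact Finset.prod_ne_zero_iff.mpr fun i hi => (Finset.mem_filter.mp hi).2
  · have h := hherm.card_nonzero_eigenvalues_add_finrank_ker
    rw [hkereq, finrank_span_eq_card (linearIndependent_of_dotProduct_eq_ite hc hdot),
      Fintype.card_fin, Fintype.card_fin] at h
    omega
end
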